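/- arXiv:1509.08269 — 3 statements merged into one kernel-verified Lean document; each statement's English description precedes it below -/
import Mathlib

section
/- Let $(V,\langle\cdot,\cdot\rangle)$ be a pseudo-Euclidean vector space of dimension $n$ and $k \geq 1$. The space $\mathcal{N}_k = \{h \in \mathrm{Sym}^k V^* \otimes \mathrm{Sym}^2 V^* \mid \forall \xi \in V: h(\xi,\ldots,\xi;\xi,\cdot) = 0\}$ has dimension $\frac{n(n+1)}{2}\binom{k+n-1}{n-1} - n\binom{k+n}{n-1}$. -/
open Module

/-- The space `𝒩ₖ ⊆ Symᵏ V* ⊗ Sym² V*` of tensors `h` with `h(ξ,…,ξ;ξ,·) = 0` for all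
`ξ ∈ V`, modelled as the space of `(k+2)`-multilinear forms which are symmetric in the
first `k` slots and in the last two slots, and which vanish when `ξ` is inserted into
all `k` symmetric slots and one of the last two slots. -/
noncomputable def Nspace (V : Type*) [AddCommGroup V] [Module ℝ V] (k : ℕ) :
    Submodule ℝ (MultilinearMap ℝ (fun _ : Fin (k + 2) => V) ℝ) where
  carrier := {h |
    (∀ (v : Fin (k + 2) → V) (σ : Equiv.Perm (Fin (k + 2))),
      σ (Fin.last (k + 1)) = Fin.last (k + 1) →
      σ (⟨k, by omega⟩ : Fin (k + 2)) = ⟨k, by omega⟩ → h (v ∘ σ) = h v) ∧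
    (∀ v : Fin (k + 2) → V,
      h (v ∘ Equiv.swap (⟨k, by omega⟩ : Fin (k + 2)) (Fin.last (k + 1))) = h v) ∧
    (∀ ξ x : V, h (Fin.snoc (fun _ : Fin (k + 1) => ξ) x) = 0)}
  add_mem' := fun ha hb =>
    ⟨fun v σ h1 h2 => by simp [MultilinearMap.add_apply, ha.1 v σ h1 h2, hb.1 v σ h1 h2],
     fun v => by simp [MultilinearMap.add_apply, ha.2.1 v, hb.2.1 v],
     fun ξ x => by simp [MultilinearMap.add_apply, ha.2.2 ξ x, hb.2.2 ξ x]⟩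
  zero_mem' := ⟨fun _ _ _ _ => rfl, fun _ => rfl, fun _ _ => rfl⟩
  smul_mem' := fun c h hh =>
    ⟨fun v σ h1 h2 => by simp [MultilinearMap.smul_apply, hh.1 v σ h1 h2],
     fun v => by simp [MultilinearMap.smul_apply, hh.2.1 v],
     fun ξ x => by simp [MultilinearMap.smul_apply, hh.2.2 ξ x]⟩

namespace NspaceAux

/-- The multiset of values of a tuple. -/
def mk {ι : Type} {m : ℕ} (f : Fin m → ι) : Sym ι m := ⟨Finset.univ.val.map f, by simp⟩

lemma mk_comp_perm {ι : Type} {m : ℕ} (f : Fin m → ι) (σ : Equiv.Perm (Fin m)) :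
    mk (f ∘ σ) = mk f := by
  apply Subtype.ext
  simp only [mk]
  rw [← Multiset.map_map, Multiset.map_univ_val_equiv]

lemma mk_snoc {ι : Type} {m : ℕ} (f : Fin m → ι) (j : ι) :
    mk (Fin.snoc f j : Fin (m + 1) → ι) = j ::ₛ mk f := by
  apply Subtype.ext
  simp only [mk, Sym.cons, Fin.univ_castSuccEmb, Finset.cons_val, Multiset.map_cons,
    Fin.snoc_last, Finset.map_val, Multiset.map_map]
  congr 1
  apply Multiset.map_congr rfl
  intro i _
  simp

lemma mk_surj {ι : Type} : ∀ {m : ℕ} (s : Sym ι m), ∃ f : Fin m → ι, mk f = s := by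
  intro m
  induction m with
  | zero => intro s; exact ⟨Fin.elim0, Subsingleton.elim _ _⟩
  | succ m ih =>
    intro s
    obtain ⟨a, t, rfl⟩ := s.exists_eq_cons_of_succ
    obtain ⟨f, rfl⟩ := ih t
    exact ⟨Fin.snoc f a, mk_snoc f a⟩

lemma exists_perm {ι : Type} [DecidableEq ι] {m : ℕ} {f g : Fin m → ι} (h : mk f = mk g) :
    ∃ σ : Equiv.Perm (Fin m), g ∘ σ = f := by
  have h1 : ∀ c, Fintype.card {a // f a = c} = Fintype.card {a // g a = c} := by
    intro c
    have := congrArg (fun s : Sym ι m => Multiset.count c s.1) h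
    simp only [mk, Multiset.count_map] at this
    rw [Fintype.card_subtype, Fintype.card_subtype]
    simpa [Finset.card, Finset.filter_val, eq_comm] using this
  refine ⟨Equiv.ofFiberEquiv (f := f) (g := g) fun c => Fintype.equivOfCardEq (h1 c), ?_⟩
  funext a
  exact Equiv.ofFiberEquiv_map _ a

lemma sum_snoc {ι M : Type} [Fintype ι] [AddCommMonoid M] {m : ℕ} (φ : (Fin (m + 1) → ι) → M) :
    ∑ F, φ F = ∑ f : Fin m → ι, ∑ j, φ (Fin.snoc f j) := by
  rw [← (Fin.snocEquiv (fun _ => ι)).sum_comp, Fintype.sum_prod_type, Finset.sum_comm]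
  rfl

variable {n k : ℕ}

/-- The polarized symmetrization map. -/
noncomputable def L (n k : ℕ) : (Sym (Fin n) k × Sym2 (Fin n) → ℝ) →ₗ[ℝ]
    (Sym (Fin n) (k + 1) × Fin n → ℝ) where
  toFun c := fun p => ∑ f : Fin (k + 1) → Fin n,
    if mk f = p.1 then c (mk (f ∘ Fin.castSucc), s(f (Fin.last k), p.2)) else 0
  map_add' c d := by
    ext p
    simp only [Pi.add_apply, ← Finset.sum_add_distrib]
    exact Finset.sum_congr rfl fun f _ => by split_ifs <;> simp
  map_smul' r c := by
    ext p
    simp [Finset.mul_sum]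

lemma L_apply (c : Sym (Fin n) k × Sym2 (Fin n) → ℝ) (s : Sym (Fin n) (k + 1)) (j : Fin n) :
    L n k c (s, j) = ∑ f : Fin k → Fin n, ∑ i : Fin n,
      if i ::ₛ mk f = s then c (mk f, s(i, j)) else 0 := by
  simp only [L, LinearMap.coe_mk, AddHom.coe_mk]
  rw [sum_snoc]
  refine Finset.sum_congr rfl fun f _ => Finset.sum_congr rfl fun i _ => ?_
  rw [mk_snoc]
  have : (Fin.snoc f i : Fin (k + 1) → Fin n) ∘ Fin.castSucc = f := by
    ext x; simp
  rw [this]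
  simp

/-- symmetric elementary weight -/
def w (a b : Fin n) : Sym2 (Fin n) → ℝ :=
  Sym2.lift ⟨fun i j => (if i = a then (if j = b then 1 else 0) else 0) +
    (if i = b then (if j = a then 1 else 0) else 0), by
      intro i j
      by_cases h1 : i = a <;> by_cases h2 : i = b <;> by_cases h3 : j = a <;>
        by_cases h4 : j = b <;> subst_vars <;> simp_all⟩

/-- elementary vectors -/
noncomputable def e (s : Sym (Fin n) (k + 1)) (j : Fin n) : Sym (Fin n) (k + 1) × Fin n → ℝ :=
  Pi.single (s, j) 1

lemma G_mem (m : Sym (Fin n) k) (a b : Fin n) :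
    e (a ::ₛ m) b + e (b ::ₛ m) a ∈ LinearMap.range (L n k) := by
  classical
  set N : ℝ := ∑ f : Fin k → Fin n, if mk f = m then 1 else 0 with hN
  have hN0 : N ≠ 0 := by
    obtain ⟨f, hf⟩ := mk_surj m
    have : (0 : ℝ) < N := by
      apply Finset.sum_pos' (fun _ _ => by split_ifs <;> norm_num)
      exact ⟨f, Finset.mem_univ _, by simp [hf]⟩
    exact this.ne'
  refine ⟨fun p => N⁻¹ * ((if p.1 = m then 1 else 0) * w a b p.2), ?_⟩
  ext ⟨s, j⟩
  rw [L_apply]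
  have : ∀ f : Fin k → Fin n, (∑ i : Fin n, if i ::ₛ mk f = s then
      N⁻¹ * ((if mk f = m then 1 else 0) * w a b s(i, j)) else 0) =
      (if mk f = m then 1 else 0) * (N⁻¹ * (e (a ::ₛ m) b + e (b ::ₛ m) a) (s, j)) := by
    intro f
    by_cases hf : mk f = m
    · simp only [hf, if_true, one_mul, w, Sym2.lift_mk, e, Pi.add_apply, Pi.single_apply,
        Prod.mk.injEq]
      have : ∀ i : Fin n, (if i ::ₛ m = s then N⁻¹ * ((if i = a then (if j = b then (1 : ℝ) else 0)
          else 0) + (if i = b then (if j = a then 1 else 0) else 0)) else 0) =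
          (if i = a then (if a ::ₛ m = s then N⁻¹ * (if j = b then 1 else 0) else 0) else 0) +
          (if i = b then (if b ::ₛ m = s then N⁻¹ * (if j = a then 1 else 0) else 0) else 0) := by
        intro i
        by_cases h1 : i = a <;> by_cases h2 : i = b <;> by_cases h3 : i ::ₛ m = s <;> 
          subst_vars <;> simp_all [mul_add]
      rw [Finset.sum_congr rfl fun i _ => this i, Finset.sum_add_distrib]
      simp only [Finset.sum_ite_eq', Finset.mem_univ, if_true, eq_comm (a := s)]
      by_cases h1 : a ::ₛ m = s <;> by_cases h2 : b ::ₛ m = s <;> simp [h1, h2, mul_add]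
    · simp [hf]
  simp only
  rw [Finset.sum_congr rfl fun f _ => this f, ← Finset.sum_mul, ← hN, ← mul_assoc,
    mul_inv_cancel₀ hN0, one_mul]

lemma L_surj (hk : 1 ≤ k) : LinearMap.range (L n k) = ⊤ := by
  obtain ⟨k, rfl⟩ : ∃ l, k = l + 1 := ⟨k - 1, by omega⟩
  have key : ∀ s j, e s j ∈ LinearMap.range (L n (k + 1)) := by
    intro s j
    obtain ⟨a, t, rfl⟩ := s.exists_eq_cons_of_succ
    obtain ⟨b, m, rfl⟩ := t.exists_eq_cons_of_succ
    have h1 := G_mem (b ::ₛ m) a j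
    have h2 := G_mem (j ::ₛ m) a b
    have h3 := G_mem (a ::ₛ m) b j
    have := Submodule.smul_mem _ (2⁻¹ : ℝ) (add_mem (sub_mem h1 h2) h3)
    convert this using 1
    rw [Sym.cons_swap j b, Sym.cons_swap j a, Sym.cons_swap b a]
    module
  rw [eq_top_iff]
  intro t _
  have : t = ∑ p, t p • e p.1 p.2 := by
    ext p
    simp [e, Pi.single_apply, Finset.sum_apply]
  rw [this]
  exact sum_mem fun p _ => Submodule.smul_mem _ _ (key _ _)

lemma finrank_ker (hk : 1 ≤ k) : (finrank ℝ (LinearMap.ker (L n k)) : ℚ) 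
    = (n * (n + 1) / 2 : ℚ) * ((k + n - 1).choose (n - 1))
        - (n : ℚ) * ((k + n).choose (n - 1)) := by
  have h := (L n k).finrank_range_add_finrank_ker
  rw [L_surj hk, finrank_top, Module.finrank_fintype_fun_eq_card,
    Module.finrank_fintype_fun_eq_card, Fintype.card_prod, Fintype.card_prod,
    Sym.card_sym_eq_choose, Sym.card_sym_eq_choose, Sym2.card, Fintype.card_fin] at h
  rcases n with _ | n
  · simp at h
    simp [h]
  · have e1 : (n + 1 + k - 1).choose k = (k + (n + 1) - 1).choose (n + 1 - 1) := by
      rw [← Nat.choose_symm_of_eq_add (n := n + 1 + k - 1) (a := n) (b := k) (by omega)]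
      congr 1; omega
    have e2 : (n + 1 + (k + 1) - 1).choose (k + 1) = (k + (n + 1)).choose (n + 1 - 1) := by
      rw [← Nat.choose_symm_of_eq_add (n := n + 1 + (k + 1) - 1) (a := n) (b := k + 1) (by omega)]
      congr 1; omega
    rw [e1, e2] at h
    have h' := congrArg (Nat.cast : ℕ → ℚ) h
    push_cast at h'
    rw [Nat.cast_choose_two] at h'
    push_cast at h' ⊢
    linarith


/-- The class of an index tuple. -/
def cls (F : Fin (k + 2) → Fin n) : Sym (Fin n) k × Sym2 (Fin n) :=
  (mk (fun i : Fin k => F i.castSucc.castSucc), s(F (Fin.last k).castSucc, F (Fin.last (k + 1))))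

lemma cls_surj (p : Sym (Fin n) k × Sym2 (Fin n)) : ∃ F : Fin (k + 2) → Fin n, cls F = p := by
  obtain ⟨m, q⟩ := p
  obtain ⟨f, rfl⟩ := mk_surj m
  induction q with
  | _ a b =>
    refine ⟨Fin.snoc (Fin.snoc f a : Fin (k + 1) → Fin n) b, ?_⟩
    simp [cls]

lemma cls_comp_perm (F : Fin (k + 2) → Fin n) (σ : Equiv.Perm (Fin (k + 2)))
    (h1 : σ (Fin.last (k + 1)) = Fin.last (k + 1))
    (h2 : σ (Fin.last k).castSucc = (Fin.last k).castSucc) : cls (F ∘ σ) = cls F := by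
  have hs : ∀ G : Fin (k + 2) → Fin n, mk G = G (Fin.last (k + 1)) ::ₛ G (Fin.last k).castSucc ::ₛ
      mk (fun i : Fin k => G i.castSucc.castSucc) := by
    intro G
    rw [← mk_snoc, ← mk_snoc]
    congr 1
    ext i
    refine Fin.lastCases ?_ (fun i => ?_) i
    · simp
    · refine Fin.lastCases ?_ (fun i => ?_) i <;> simp
  have := mk_comp_perm F σ
  rw [hs, hs F] at this
  simp only [Function.comp_apply, h1, h2, Sym.cons_inj_right] at this
  simp only [cls, Function.comp_apply, h1, h2, this]

lemma cls_comp_swap (F : Fin (k + 2) → Fin n) :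
    cls (F ∘ Equiv.swap (Fin.last k).castSucc (Fin.last (k + 1))) = cls F := by
  simp only [cls, Function.comp_apply, Equiv.swap_apply_left, Equiv.swap_apply_right]
  refine Prod.ext ?_ Sym2.eq_swap
  simp only
  congr 1
  ext i
  rw [Equiv.swap_apply_of_ne_of_ne]
  · simp [Fin.ext_iff]; omega
  · simp [Fin.ext_iff]; omega

lemma exists_perm_cls {F G : Fin (k + 2) → Fin n} (h : cls F = cls G) :
    ∃ σ : Equiv.Perm (Fin (k + 2)), σ (Fin.last (k + 1)) = Fin.last (k + 1) ∧
      σ (Fin.last k).castSucc = (Fin.last k).castSucc ∧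
      (G ∘ σ = F ∨
        G ∘ σ = F ∘ Equiv.swap (Fin.last k).castSucc (Fin.last (k + 1))) := by
  obtain ⟨h1, h2⟩ := Prod.ext_iff.1 h
  obtain ⟨τ, hτ⟩ := exists_perm h1
  let ε : Fin k ↪ Fin (k + 2) := Fin.castSuccEmb.trans Fin.castSuccEmb
  have a1 : (τ.viaEmbedding ε) (Fin.last (k + 1)) = Fin.last (k + 1) := by
    apply Equiv.Perm.viaEmbedding_apply_of_notMem
    rintro ⟨i, hi⟩
    simp [ε, Fin.ext_iff] at hi
    omega
  have a2 : (τ.viaEmbedding ε) (Fin.last k).castSucc = (Fin.last k).castSucc := by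
    apply Equiv.Perm.viaEmbedding_apply_of_notMem
    rintro ⟨i, hi⟩
    simp [ε, Fin.ext_iff] at hi
    omega
  have a3 : ∀ i : Fin k, (τ.viaEmbedding ε) i.castSucc.castSucc = (τ i).castSucc.castSucc :=
    fun i => Equiv.Perm.viaEmbedding_apply τ ε i
  have a4 : ∀ i : Fin k, G (τ i).castSucc.castSucc = F i.castSucc.castSucc :=
    fun i => congrFun hτ i
  refine ⟨τ.viaEmbedding ε, a1, a2, ?_⟩
  simp only [cls, Sym2.eq_iff] at h2
  rcases h2 with ⟨h3, h4⟩ | ⟨h3, h4⟩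
  · left
    funext i
    refine Fin.lastCases ?_ (fun i => ?_) i
    · simp [a1, h4]
    · refine Fin.lastCases ?_ (fun i => ?_) i
      · simp [a2, h3]
      · simp [a3, a4]
  · right
    funext i
    refine Fin.lastCases ?_ (fun i => ?_) i
    · simp [a1, h3]
    · refine Fin.lastCases ?_ (fun i => ?_) i
      · simp [a2, h4]
      · rw [Function.comp_apply, Function.comp_apply, a3, a4, Equiv.swap_apply_of_ne_of_ne]
        · simp [Fin.ext_iff]; omega
        · simp [Fin.ext_iff]; omega

section
variable {V : Type*} [AddCommGroup V] [Module ℝ V] (b : Basis (Fin n) ℝ V)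

/-- The multilinear form with given symmetric coefficients. -/
noncomputable def P (k : ℕ) : (Sym (Fin n) k × Sym2 (Fin n) → ℝ) →ₗ[ℝ]
    MultilinearMap ℝ (fun _ : Fin (k + 2) => V) ℝ where
  toFun c := ∑ F : Fin (k + 2) → Fin n, c (cls F) •
    (MultilinearMap.mkPiAlgebra ℝ (Fin (k + 2)) ℝ).compLinearMap (fun i => b.coord (F i))
  map_add' c d := by
    simp only [Pi.add_apply, add_smul, Finset.sum_add_distrib]
  map_smul' r c := by
    simp [Finset.smul_sum, mul_smul]

lemma P_apply (c : Sym (Fin n) k × Sym2 (Fin n) → ℝ) (v : Fin (k + 2) → V) :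
    P b k c v = ∑ F : Fin (k + 2) → Fin n, c (cls F) * ∏ i, b.coord (F i) (v i) := by
  simp [P, MultilinearMap.sum_apply]

lemma P_basis (c : Sym (Fin n) k × Sym2 (Fin n) → ℝ) (F : Fin (k + 2) → Fin n) :
    P b k c (fun i => b (F i)) = c (cls F) := by
  rw [P_apply, Finset.sum_eq_single F]
  · simp
  · intro G _ hG
    obtain ⟨i, hi⟩ := Function.ne_iff.1 hG
    rw [Finset.prod_eq_zero (Finset.mem_univ i), mul_zero]
    simp [Finsupp.single_apply, Ne.symm hi]
  · simp

lemma P_inj : Function.Injective (P b k) := by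
  intro c d h
  ext p
  obtain ⟨F, rfl⟩ := cls_surj p
  rw [← P_basis b c, h, P_basis]

lemma P_comp_perm (c : Sym (Fin n) k × Sym2 (Fin n) → ℝ) (σ : Equiv.Perm (Fin (k + 2)))
    (hσ : ∀ F : Fin (k + 2) → Fin n, cls (F ∘ σ) = cls F) (v : Fin (k + 2) → V) :
    P b k c (v ∘ σ) = P b k c v := by
  rw [P_apply, P_apply, ← (Equiv.arrowCongr σ.symm (Equiv.refl (Fin n))).sum_comp]
  refine Finset.sum_congr rfl fun F _ => ?_
  have : (Equiv.arrowCongr σ.symm (Equiv.refl (Fin n))) F = F ∘ σ := by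
    ext; simp [Equiv.arrowCongr]
  rw [this, hσ]
  congr 1
  exact Equiv.prod_comp σ (fun i => b.coord (F i) (v i))

lemma P_snoc (c : Sym (Fin n) k × Sym2 (Fin n) → ℝ) (ξ x : V) :
    P b k c (Fin.snoc (fun _ : Fin (k + 1) => ξ) x) =
      ∑ j, b.coord j x * ∑ s : Sym (Fin n) (k + 1),
        L n k c (s, j) * (s.1.map fun i => b.coord i ξ).prod := by
  rw [P_apply, sum_snoc, Finset.sum_comm]
  refine Finset.sum_congr rfl fun j _ => ?_
  rw [Finset.mul_sum]
  simp only [L, LinearMap.coe_mk, AddHom.coe_mk, Finset.sum_mul, Finset.mul_sum]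
  rw [Finset.sum_comm]
  refine Finset.sum_congr rfl fun f _ => ?_
  simp only [ite_mul, zero_mul, mul_ite, mul_zero, Finset.sum_ite_eq, Finset.mem_univ, if_true]
  rw [Fin.prod_univ_castSucc]
  have : ((mk f).1.map fun i => b.coord i ξ).prod = ∏ i, b.coord (f i) ξ := by
    simp only [mk, Multiset.map_map]
    rfl
  rw [this]
  simp [cls, Function.comp_def]
  ring

lemma L_zero_of (c : Sym (Fin n) k × Sym2 (Fin n) → ℝ)
    (h : ∀ ξ x : V, P b k c (Fin.snoc (fun _ : Fin (k + 1) => ξ) x) = 0) : L n k c = 0 := by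
  classical
  ext ⟨s, j⟩
  let Q : MvPolynomial (Fin n) ℝ := ∑ s : Sym (Fin n) (k + 1),
    MvPolynomial.monomial (Multiset.toFinsupp s.1) (L n k c (s, j))
  have hQ : Q = 0 := by
    apply MvPolynomial.funext
    intro t
    have h1 := h (∑ i, t i • b i) (b j)
    rw [P_snoc, Finset.sum_eq_single j] at h1
    · simp only [Basis.coord_apply, Basis.repr_self, Finsupp.single_eq_same, one_mul,
        Basis.repr_sum_self] at h1
      simp only [Q, map_sum, MvPolynomial.eval_monomial, map_zero]
      rw [← h1]
      refine Finset.sum_congr rfl fun s _ => ?_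
      congr 1
      rw [Finset.prod_multiset_map_count]
      rfl
    · intro i _ hi
      simp [Finsupp.single_apply, hi.symm]
    · simp
  have h2 := congrArg (MvPolynomial.coeff (Multiset.toFinsupp s.1)) hQ
  simp only [Q, MvPolynomial.coeff_sum, MvPolynomial.coeff_monomial, MvPolynomial.coeff_zero] at h2
  rw [Finset.sum_eq_single s] at h2
  · simpa using h2
  · intro t _ ht
    rw [if_neg]
    intro h3
    exact ht (Subtype.ext (Multiset.toFinsupp.injective h3))
  · simp

lemma Nspace_eq : Nspace V k = (LinearMap.ker (L n k)).map (P b k) := by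
  ext h
  rw [Submodule.mem_map]
  constructor
  · rintro ⟨h1, h2, h3⟩
    choose R hR using cls_surj (n := n) (k := k)
    let c : Sym (Fin n) k × Sym2 (Fin n) → ℝ := fun p => h (fun i => b (R p i))
    have hP : P b k c = h := by
      refine Basis.ext_multilinear (fun _ => b) fun F => ?_
      rw [P_basis]
      obtain ⟨σ, s1, s2, s3⟩ := exists_perm_cls (hR (cls F))
      have h1' := h1 (fun i => b (F i)) σ s1 s2
      rcases s3 with s3 | s3
      · rw [← h1']
        change h (fun i => b (R (cls F) i)) = h (fun i => b ((F ∘ σ) i))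
        rw [s3]
      · have h2' := h2 (fun i => b (R (cls F) i))
        rw [← h1']
        change h (fun i => b (R (cls F) i)) = h (fun i => b ((F ∘ σ) i))
        rw [s3]
        exact h2'.symm
    refine ⟨c, ?_, hP⟩
    rw [LinearMap.mem_ker]
    apply L_zero_of b
    rw [hP]
    exact h3
  · rintro ⟨c, hc, rfl⟩
    rw [LinearMap.mem_ker] at hc
    refine ⟨fun v σ h1 h2 => P_comp_perm b c σ (fun F => cls_comp_perm F σ h1 h2) v,
      fun v => P_comp_perm b c _ (fun F => cls_comp_swap F) v, fun ξ x => ?_⟩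
    rw [P_snoc, hc]
    simp

end

end NspaceAux

/-- for a pseudo-Euclidean vector space `(V, ⟨·,·⟩)` of dimension `n` and
`k ≥ 1`, the space `𝒩ₖ` has dimension `n(n+1)/2 · C(k+n-1, n-1) - n · C(k+n, n-1)`. -/
theorem dim_Nspace (V : Type*) [AddCommGroup V] [Module ℝ V] [FiniteDimensional ℝ V]
    (B : LinearMap.BilinForm ℝ V) (hBsymm : ∀ x y, B x y = B y x)
    (hBnondeg : B.Nondegenerate)
    (n k : ℕ) (hn : finrank ℝ V = n) (hk : 1 ≤ k) :
    (finrank ℝ (Nspace V k) : ℚ)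
      = (n * (n + 1) / 2 : ℚ) * ((k + n - 1).choose (n - 1))
        - (n : ℚ) * ((k + n).choose (n - 1)) := by
  subst hn
  have b := Module.finBasis ℝ V
  rw [NspaceAux.Nspace_eq b, ← NspaceAux.finrank_ker hk]
  congr 1
  exact (Submodule.equivMapOfInjective _ (NspaceAux.P_inj b) _).finrank_eq.symm
end

section
/- Let $V$ be a real vector space and let $\nabla^{k)}R \in \otimes^{k+4}V^*$ satisfy: symmetry in the first $k$ slots; for each choice of the first $k$ arguments, the resulting 4-tensor is an algebraic curvature tensor; the second Bianchi identity in slots $k, k+1, k+2$ (with pair symmetry); and full symmetry obtained from vanishing Ricci-type commutators (i.e. $\nabla^{k)}R$ is a linear algebraic curvature $k$-jet). Define its symmetrization $\mathcal{R}^{k)} \in \mathrm{Sym}^{k+2}V^* \otimes \mathrm{Sym}^2 V^*$ by polarizing $\mathcal{R}^{k)}(\xi;x,y) := \nabla^{k)}_{\xi,\ldots,\xi}R(x,\xi,\xi,y)$. Then $\nabla^{k)}R$ is reconstructed from $\mathcal{R}^{k)}$ by $\nabla^{k)}_{x_1,\ldots,x_k}R(x_a,x_b,x_c,x_d) = -\frac{k+1}{k+3}\,(\owedge\,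 \mathcal{R}^{k)})(x_1,\ldots,x_k;x_a,x_b,x_c,x_d)$, where $\owedge$ is the Kulkarni–Nomizu-type map $(\owedge h)(x_1,\ldots,x_k;x_a,x_b,x_c,x_d) = h(x_1,\ldots,x_k,x_a,x_c;x_b,x_d) - h(x_1,\ldots,x_k,x_b,x_c;x_a,x_d) - h(x_1,\ldots,x_k,x_a,x_d;x_b,x_c) + h(x_1,\ldots,x_k,x_b,x_d;x_a,x_c)$. -/
open Finset in
/-- Derivative at `0` of a multilinear map along a line. -/
lemma jet_hasDeriv {V : Type*} [AddCommGroup V] [Module ℝ V] {n : ℕ}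
    (f : MultilinearMap ℝ (fun _ : Fin n => V) ℝ) (u w : Fin n → V) :
    HasDerivAt (fun t : ℝ => f (u + t • w)) (∑ i, f (Function.update u i (w i))) 0 := by
  have hpw : ∀ (t : ℝ) (s : Finset (Fin n)),
      f (s.piecewise (t • w) u) = t ^ #s * f (s.piecewise w u) := by
    intro t s
    have h := f.map_piecewise_smul (fun _ => t) (s.piecewise w u) s
    rw [Finset.prod_const, smul_eq_mul] at h
    rw [← h]
    congr 1
    ext i
    by_cases hi : i ∈ s <;> simp [hi]
  have hexp : (fun t : ℝ => f (u + t • w)) = fun t : ℝ =>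
      f u + t * (∑ i, f (Function.update u i (w i)))
        + ∑ s : Finset (Fin n) with 2 ≤ #s, t ^ #s * f (s.piecewise w u) := by
    funext t
    rw [f.map_add_eq_map_add_linearDeriv_add, LinearMap.map_smul, f.linearDeriv_apply,
      smul_eq_mul]
    simp_rw [hpw]
  rw [hexp]
  have h1 : HasDerivAt (fun t : ℝ => f u + t * (∑ i, f (Function.update u i (w i))))
      (∑ i, f (Function.update u i (w i))) 0 := by
    simpa using ((hasDerivAt_id (0 : ℝ)).mul_const
      (∑ i, f (Function.update u i (w i)))).const_add (f u)
  have h2 : HasDerivAt (fun t : ℝ => ∑ s : Finset (Fin n) with 2 ≤ #s,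
      t ^ #s * f (s.piecewise w u)) (∑ s : Finset (Fin n) with 2 ≤ #s, 0) 0 := by
    apply HasDerivAt.fun_sum
    intro s hs
    have hs2 : 2 ≤ #s := (Finset.mem_filter.mp hs).2
    have h := (hasDerivAt_pow (#s) (0 : ℝ)).mul_const (f (s.piecewise w u))
    have h0 : (0 : ℝ) ^ (#s - 1) = 0 := zero_pow (by omega)
    simpa [h0] using h
  have h3 := h1.add h2
  rw [Finset.sum_const_zero, add_zero] at h3
  exact h3

/-- First polarization step. -/
lemma jet_polar1 {V : Type*} [AddCommGroup V] [Module ℝ V] {n : ℕ}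
    (f g : MultilinearMap ℝ (fun _ : Fin n => V) ℝ)
    (h : ∀ ξ : V, f (fun _ => ξ) = g (fun _ => ξ)) (ξ a : V) :
    ∑ i, f (Function.update (fun _ => ξ) i a) = ∑ i, g (Function.update (fun _ => ξ) i a) := by
  have hf := jet_hasDeriv f (fun _ => ξ) (fun _ => a)
  have hg := jet_hasDeriv g (fun _ => ξ) (fun _ => a)
  have : (fun t : ℝ => f ((fun _ => ξ) + t • (fun _ => a)))
      = (fun t : ℝ => g ((fun _ => ξ) + t • (fun _ => a))) := by
    funext t
    exact h (ξ + t • a)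
  rw [this] at hf
  exact hf.unique hg

/-- Second polarization step. -/
lemma jet_polar2 {V : Type*} [AddCommGroup V] [Module ℝ V] {n : ℕ}
    (f g : MultilinearMap ℝ (fun _ : Fin n => V) ℝ)
    (h : ∀ ξ : V, f (fun _ => ξ) = g (fun _ => ξ)) (ξ a c : V) :
    ∑ i, ∑ j, (if i = j then 0 else
        f (Function.update (Function.update (fun _ => ξ) i a) j c))
      = ∑ i, ∑ j, (if i = j then 0 else
        g (Function.update (Function.update (fun _ => ξ) i a) j c)) := by
  have key : ∀ p : MultilinearMap ℝ (fun _ : Fin n => V) ℝ,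
      HasDerivAt (fun t : ℝ => ∑ i, p (Function.update (fun _ => ξ + t • c) i a))
        (∑ i, ∑ j, (if i = j then 0 else
          p (Function.update (Function.update (fun _ => ξ) i a) j c))) 0 := by
    intro p
    apply HasDerivAt.fun_sum
    intro i _
    have hp := jet_hasDeriv p (Function.update (fun _ => ξ) i a) (Function.update (fun _ => c) i 0)
    have e1 : (fun t : ℝ => p (Function.update (fun _ => ξ) i a
        + t • Function.update (fun _ => c) i 0))
        = fun t : ℝ => p (Function.update (fun _ => ξ + t • c) i a) := by
      funext t
      congr 1
      ext l
      by_cases hl : l = i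
      · subst hl; simp
      · simp [hl]
    have e2 : (∑ j, p (Function.update (Function.update (fun _ => ξ) i a) j
        (Function.update (fun _ => c) i 0 j)))
        = ∑ j, (if i = j then 0 else
          p (Function.update (Function.update (fun _ => ξ) i a) j c)) := by
      refine Finset.sum_congr rfl fun j _ => ?_
      by_cases hij : i = j
      · subst hij
        rw [if_pos rfl, Function.update_self]
        exact p.map_update_zero _ _
      · rw [if_neg hij, Function.update_of_ne (Ne.symm hij)]
    rw [e1, e2] at hp
    exact hp
  have hf := key f
  have : (fun t : ℝ => ∑ i, f (Function.update (fun _ => ξ + t • c) i a))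
      = (fun t : ℝ => ∑ i, g (Function.update (fun _ => ξ + t • c) i a)) := by
    funext t
    exact jet_polar1 f g h _ _
  rw [this] at hf
  exact hf.unique (key g)

/-- A symmetric multilinear map that vanishes on the diagonal is zero. -/
lemma jet_sym_zero {V : Type*} [AddCommGroup V] [Module ℝ V] : ∀ {n : ℕ}
    (f : MultilinearMap ℝ (fun _ : Fin n => V) ℝ)
    (_ : ∀ (v : Fin n → V) (σ : Equiv.Perm (Fin n)), f (v ∘ σ) = f v)
    (_ : ∀ ξ : V, f (fun _ => ξ) = 0) (v : Fin n → V), f v = 0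
  | 0, f, _, hd, v => by
    have : v = fun _ => 0 := by ext i; exact i.elim0
    rw [this]; exact hd 0
  | n + 1, f, hs, hd, v => by
    have hpol : ∀ ξ a : V, f (Fin.cons a (fun _ => ξ)) = 0 := by
      intro ξ a
      have h := jet_polar1 f 0 (fun ξ => by simpa using hd ξ) ξ a
      have hterm : ∀ i : Fin (n + 1), f (Function.update (fun _ => ξ) i a)
          = f (Fin.cons a (fun _ => ξ)) := by
        intro i
        rw [← hs _ (Equiv.swap 0 i)]
        congr 1
        ext l
        refine Fin.cases ?_ (fun l => ?_) l
        · simp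
        · simp only [Function.comp, Fin.cons_succ]
          rw [Function.update_of_ne]
          intro hh
          have := (Equiv.swap 0 i).injective (hh.trans (Equiv.swap_apply_left 0 i).symm)
          exact Fin.succ_ne_zero l this
      simp only [hterm, _root_.zero_apply, Finset.sum_const_zero, Finset.sum_const,
        Finset.card_univ, Fintype.card_fin, nsmul_eq_mul] at h
      rcases mul_eq_zero.mp h with h | h
      · exfalso
        have : ((n + 1 : ℕ) : ℝ) ≠ 0 := by positivity
        exact this h
      · exact h
    have hc := jet_sym_zero (f.curryLeft (v 0)) (fun w σ => by
        rw [f.curryLeft_apply, f.curryLeft_apply]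
        rw [← hs (Fin.cons (v 0) w) (Equiv.Perm.decomposeFin.symm (0, σ))]
        congr 1
        ext l
        refine Fin.cases ?_ (fun l => ?_) l
        · simp
        · simp) (fun ξ => by
        rw [f.curryLeft_apply]; exact hpol ξ (v 0)) (Fin.tail v)
    rw [f.curryLeft_apply, Fin.cons_self_tail] at hc
    exact hc

lemma jet_sym_pair {V : Type*} {k : ℕ} (f : (Fin (k + 2) → V) → ℝ)
    (hs : ∀ (v : Fin (k + 2) → V) (σ : Equiv.Perm (Fin (k + 2))), f (v ∘ σ) = f v)
    (ξ a c : V) (i j : Fin (k + 2)) (hij : i ≠ j) :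
    f (Function.update (Function.update (fun _ => ξ) i a) j c)
      = f (Fin.snoc (Fin.snoc (fun _ : Fin k => ξ) a : Fin (k + 1) → V) c) := by
  set σ₁ : Equiv.Perm (Fin (k + 2)) := Equiv.swap (Fin.last (k + 1)) j with hσ₁
  set i' := σ₁.symm i with hi'
  have hi'ne : i' ≠ Fin.last (k + 1) := by
    intro h
    apply hij
    have : σ₁ i' = i := by simp [hi']
    rw [← this, h, hσ₁, Equiv.swap_apply_left]
  set σ : Equiv.Perm (Fin (k + 2)) := σ₁ * Equiv.swap (Fin.last k).castSucc i' with hσ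
  have h1 : σ (Fin.last (k + 1)) = j := by
    rw [hσ, Equiv.Perm.mul_apply, Equiv.swap_apply_of_ne_of_ne _ hi'ne.symm, hσ₁,
      Equiv.swap_apply_left]
    exact (Fin.castSucc_lt_last _).ne'
  have h2 : σ (Fin.last k).castSucc = i := by
    rw [hσ, Equiv.Perm.mul_apply, Equiv.swap_apply_left, hi', Equiv.apply_symm_apply]
  rw [← hs _ σ]
  congr 1
  ext l
  refine Fin.lastCases ?_ (fun l => ?_) l
  · simp [h1]
  · have hl : σ l.castSucc ≠ j := fun h => (Fin.castSucc_lt_last l).ne (σ.injective (h.trans h1.symm))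
    rw [Function.comp_apply, Function.update_of_ne hl, Fin.snoc_castSucc]
    revert hl
    refine Fin.lastCases ?_ (fun l => ?_) l
    · simp [h2]
    · intro _
      have hl : σ l.castSucc.castSucc ≠ i := fun h => by
        have := σ.injective (h.trans h2.symm)
        exact (Fin.castSucc_lt_last l).ne (Fin.castSucc_injective _ this)
      rw [Function.update_of_ne hl, Fin.snoc_castSucc]

/-- Evaluation of a 4-tensor at its first and last slots. -/
def jetEval {V : Type*} [AddCommGroup V] [Module ℝ V] (x y : V) :
    (V →ₗ[ℝ] V →ₗ[ℝ] V →ₗ[ℝ] V →ₗ[ℝ] ℝ) →ₗ[ℝ] (V →ₗ[ℝ] V →ₗ[ℝ] ℝ) where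
  toFun L := (L x).compr₂ (LinearMap.applyₗ y)
  map_add' L M := by ext; simp
  map_smul' r L := by ext; simp

/-- Evaluation of a bilinear map. -/
def jetEval2 {V : Type*} [AddCommGroup V] [Module ℝ V] (x y : V) :
    (V →ₗ[ℝ] V →ₗ[ℝ] ℝ) →ₗ[ℝ] ℝ where
  toFun L := L x y
  map_add' L M := by simp
  map_smul' r L := by simp

/-- Expansion of the polarization. -/
lemma jet_expand {V : Type*} [AddCommGroup V] [Module ℝ V] {k : ℕ}
    (T : MultilinearMap ℝ (fun _ : Fin k => V) (V →ₗ[ℝ] V →ₗ[ℝ] V →ₗ[ℝ] V →ₗ[ℝ] ℝ))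
    (RR : MultilinearMap ℝ (fun _ : Fin (k + 2) => V) (V →ₗ[ℝ] V →ₗ[ℝ] ℝ))
    (hRsym : ∀ (w : Fin (k + 2) → V) (σ : Equiv.Perm (Fin (k + 2))), RR (w ∘ σ) = RR w)
    (hdiag : ∀ ξ x y, RR (fun _ => ξ) x y = T (fun _ => ξ) x ξ ξ y) (ξ a c x y : V) :
    ((k : ℝ) + 2) * ((k : ℝ) + 1) *
        RR (Fin.snoc (Fin.snoc (fun _ : Fin k => ξ) a : Fin (k + 1) → V) c) x y
      = (∑ i : Fin k, ∑ j : Fin k, (if i = j then 0 else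
          T (Function.update (Function.update (fun _ => ξ) i a) j c) x ξ ξ y))
        + (∑ i : Fin k, (T (Function.update (fun _ => ξ) i a) x c ξ y
            + T (Function.update (fun _ => ξ) i a) x ξ c y
            + T (Function.update (fun _ => ξ) i c) x a ξ y
            + T (Function.update (fun _ => ξ) i c) x ξ a y))
        + T (fun _ => ξ) x a c y + T (fun _ => ξ) x c a y := by
  set f : MultilinearMap ℝ (fun _ : Fin (k + 2) => V) ℝ :=
    (jetEval2 x y).compMultilinearMap RR with hf
  set g : MultilinearMap ℝ (fun _ : Fin (k + 2) => V) ℝ :=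
    MultilinearMap.uncurryRight (n := k + 1) (M := fun _ => V)
      (MultilinearMap.uncurryRight (n := k) (M := fun _ => V)
        ((jetEval x y).compMultilinearMap T)) with hg
  have hgv : ∀ w, g w = T (Fin.init (Fin.init w)) x (w (Fin.last k).castSucc)
      (w (Fin.last (k + 1))) y := fun w => rfl
  have hfv : ∀ w, f w = RR w x y := fun w => rfl
  have h := jet_polar2 f g (fun ξ => by rw [hgv, hfv]; exact hdiag ξ x y) ξ a c
  have hL : ∀ i j : Fin (k + 2), (if i = j then 0 else
      f (Function.update (Function.update (fun _ => ξ) i a) j c))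
      = (if i = j then 0 else
        RR (Fin.snoc (Fin.snoc (fun _ : Fin k => ξ) a : Fin (k + 1) → V) c) x y) := by
    intro i j
    split_ifs with hij
    · rfl
    · rw [← hfv]
      exact jet_sym_pair f (fun v σ => by rw [hfv, hfv, hRsym]) ξ a c i j hij
  simp only [hL] at h
  have hsum : ∀ (r : ℝ), ∑ i : Fin (k + 2), ∑ j : Fin (k + 2), (if i = j then 0 else r)
      = ((k : ℝ) + 2) * ((k : ℝ) + 1) * r := by
    intro r
    have : ∀ i j : Fin (k + 2), (if i = j then 0 else r) = r - (if i = j then r else 0) := by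
      intro i j; split_ifs <;> simp
    simp [this]
    ring
  rw [hsum] at h
  rw [h]
  have e1 : ∀ i : Fin k, i.castSucc ≠ Fin.last k := fun i => (Fin.castSucc_lt_last i).ne
  have e2 : ∀ i : Fin (k + 1), i.castSucc ≠ Fin.last (k + 1) := fun i => (Fin.castSucc_lt_last i).ne
  have hi : ∀ (m : ℕ), Fin.init (α := fun _ : Fin (m + 1) => V) (fun _ => ξ) = fun _ => ξ :=
    fun m => rfl
  simp only [Fin.sum_univ_castSucc, hgv, Fin.init_update_castSucc, Fin.init_update_last, hi,
    Fin.castSucc_inj, e1, (e1 _).symm, e2, (e2 _).symm, if_false, if_true, Function.update_self,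
    Function.update_of_ne, ne_eq, not_false_eq_true, Finset.sum_add_distrib]
  ring

/-- Symmetry is inherited after fixing the last argument. -/
lemma jet_snoc_perm {V : Type*} {n : ℕ} (σ : Equiv.Perm (Fin n)) :
    ∃ τ : Equiv.Perm (Fin (n + 1)), ∀ (v : Fin n → V) (a : V),
      (Fin.snoc (v ∘ σ) a : Fin (n + 1) → V) = (Fin.snoc v a : Fin (n + 1) → V) ∘ τ := by
  refine ⟨finSuccEquivLast.symm.permCongr (Equiv.optionCongr σ), fun v a => ?_⟩
  ext l
  refine Fin.lastCases ?_ (fun l => ?_) l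
  · simp [Equiv.permCongr_apply]
  · simp [Equiv.permCongr_apply]

/-- The map `v ↦ RR(v,p,q;x,y)`. -/
def jetFix {V : Type*} [AddCommGroup V] [Module ℝ V] {k : ℕ}
    (RR : MultilinearMap ℝ (fun _ : Fin (k + 2) => V) (V →ₗ[ℝ] V →ₗ[ℝ] ℝ)) (p q x y : V) :
    MultilinearMap ℝ (fun _ : Fin k => V) ℝ :=
  (LinearMap.applyₗ p).compMultilinearMap (MultilinearMap.curryRight (n := k) (M := fun _ => V)
    ((LinearMap.applyₗ q).compMultilinearMap (MultilinearMap.curryRight (n := k + 1)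
      (M := fun _ => V) ((jetEval2 x y).compMultilinearMap RR))))

lemma jetFix_apply {V : Type*} [AddCommGroup V] [Module ℝ V] {k : ℕ}
    (RR : MultilinearMap ℝ (fun _ : Fin (k + 2) => V) (V →ₗ[ℝ] V →ₗ[ℝ] ℝ)) (p q x y : V)
    (v : Fin k → V) :
    jetFix RR p q x y v = RR (Fin.snoc (Fin.snoc v p : Fin (k + 1) → V) q) x y := rfl

/-- The reconstruction formula on the diagonal. -/
lemma jet_diag {V : Type*} [AddCommGroup V] [Module ℝ V] {k : ℕ}
    (T : MultilinearMap ℝ (fun _ : Fin k => V) (V →ₗ[ℝ] V →ₗ[ℝ] V →ₗ[ℝ] V →ₗ[ℝ] ℝ))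
    (hanti : ∀ v a b c d, T v a b c d = - T v b a c d)
    (hpair : ∀ v a b c d, T v a b c d = T v c d a b)
    (hb1 : ∀ v a b c y, T v a b c y + T v b c a y + T v c a b y = 0)
    (hb2 : ∀ (i : Fin k) (v : Fin k → V) (x1 x2 x3 y z : V),
      T (Function.update v i x1) x2 x3 y z + T (Function.update v i x2) x3 x1 y z
        + T (Function.update v i x3) x1 x2 y z = 0)
    (RR : MultilinearMap ℝ (fun _ : Fin (k + 2) => V) (V →ₗ[ℝ] V →ₗ[ℝ] ℝ))
    (hRsym : ∀ (w : Fin (k + 2) → V) (σ : Equiv.Perm (Fin (k + 2))), RR (w ∘ σ) = RR w)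
    (hdiag : ∀ ξ x y, RR (fun _ => ξ) x y = T (fun _ => ξ) x ξ ξ y)
    (ξ a b c d : V) :
    -((k : ℝ) + 3) * ((k : ℝ) + 2) * T (fun _ => ξ) a b c d = ((k : ℝ) + 2) * ((k : ℝ) + 1) *
        (jetFix RR a c b d (fun _ => ξ) - jetFix RR b c a d (fun _ => ξ)
          - jetFix RR a d b c (fun _ => ξ) + jetFix RR b d a c (fun _ => ξ)) := by
  have hanti2 : ∀ v a b c d, T v a b c d = - T v a b d c := fun v a b c d => by
    rw [hpair, hanti, hpair]
  have hself : ∀ i : Fin k, Function.update (fun _ : Fin k => ξ) i ξ = fun _ => ξ :=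
    fun i => Function.update_eq_self i _
  -- second Bianchi for the remaining derivative slot, applied to both pairs
  have hC : ∀ (i : Fin k), ∀ p q r s : V,
      T (Function.update (fun _ => ξ) i r) p q ξ s - T (Function.update (fun _ => ξ) i s) p q ξ r
        = T (fun _ => ξ) p q r s := by
    intro i p q r s
    have h := hb2 i (fun _ => ξ) r ξ s p q
    rw [hself, hpair _ ξ s, hpair _ s r, hpair _ r ξ, hanti2 _ p q s r, hanti2 _ p q r ξ] at h
    linarith
  have hN2 : ∀ i j : Fin k,
      (if i = j then 0 else
          T (Function.update (Function.update (fun _ => ξ) i a) j c) b ξ ξ d)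
        - (if i = j then 0 else
          T (Function.update (Function.update (fun _ => ξ) i b) j c) a ξ ξ d)
        - (if i = j then 0 else
          T (Function.update (Function.update (fun _ => ξ) i a) j d) b ξ ξ c)
        + (if i = j then 0 else
          T (Function.update (Function.update (fun _ => ξ) i b) j d) a ξ ξ c)
        = if i = j then 0 else - T (fun _ => ξ) a b c d := by
    intro i j
    split_ifs with hij
    · simp
    · have step : ∀ r s : V,
          T (Function.update (Function.update (fun _ => ξ) i a) j r) b ξ ξ s
          - T (Function.update (Function.update (fun _ => ξ) i b) j r) a ξ ξ s
          = - T (Function.update (fun _ => ξ) j r) a b ξ s := by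
        intro r s
        have hself2 : Function.update (Function.update (fun _ : Fin k => ξ) j r) i ξ
            = Function.update (fun _ => ξ) j r := by
          rw [Function.update_comm (Ne.symm hij), hself]
        have h := hb2 i (Function.update (fun _ => ξ) j r) a b ξ ξ s
        rw [hself2, Function.update_comm (Ne.symm hij), Function.update_comm (Ne.symm hij),
          hanti _ ξ a] at h
        linarith
      have h1 := step c d
      have h2 := step d c
      have h3 := hC j a b c d
      linarith
  have hN1 : ∀ i : Fin k,
      (T (Function.update (fun _ => ξ) i a) b c ξ d + T (Function.update (fun _ => ξ) i a) b ξ c d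
        + T (Function.update (fun _ => ξ) i c) b a ξ d
        + T (Function.update (fun _ => ξ) i c) b ξ a d)
      - (T (Function.update (fun _ => ξ) i b) a c ξ d + T (Function.update (fun _ => ξ) i b) a ξ c d
        + T (Function.update (fun _ => ξ) i c) a b ξ d
        + T (Function.update (fun _ => ξ) i c) a ξ b d)
      - (T (Function.update (fun _ => ξ) i a) b d ξ c + T (Function.update (fun _ => ξ) i a) b ξ d c
        + T (Function.update (fun _ => ξ) i d) b a ξ c
        + T (Function.update (fun _ => ξ) i d) b ξ a c)
      + (T (Function.update (fun _ => ξ) i b) a d ξ c + T (Function.update (fun _ => ξ) i b) a ξ d c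
        + T (Function.update (fun _ => ξ) i d) a b ξ c
        + T (Function.update (fun _ => ξ) i d) a ξ b c)
      = -6 * T (fun _ => ξ) a b c d := by
    intro i
    have A : ∀ r s : V, ∀ v : Fin k → V,
        T v b a r s + T v b r a s - T v a b r s - T v a r b s = -3 * T v a b r s := by
      intro r s v
      have h1 := hb1 v b r a s
      have h2 := hanti v b a r s
      have h3 := hanti v r a b s
      linarith
    have B : ∀ p q : V, ∀ v : Fin k → V,
        T v q c p d + T v q p c d - T v q d p c - T v q p d c = 3 * T v q p c d := by
      intro p q v
      have h1 := hb1 v c p d q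
      have e1 := hpair v q c p d
      have e2 := hpair v q d p c
      have e3 := hpair v q p c d
      have e4 := hanti2 v q p d c
      have e5 := hanti2 v p d q c
      have e6 := hanti2 v c p d q
      have e7 := hpair v c p q d
      have e8 := hanti v p c q d
      have e9 := hanti2 v p d c q
      have e10 := hanti2 v d c p q
      have e11 := hanti v d c q p
      have e12 := hpair v c p q d
      have e13 := hpair v p c q d
      have e14 := hanti2 v d c p q
      have e15 := hpair v q d c p
      have e16 := hanti2 v q d c p
      linarith
    have hA1 := A ξ d (Function.update (fun _ => ξ) i c)
    have hA2 := A ξ c (Function.update (fun _ => ξ) i d)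
    have hB1 := B ξ b (Function.update (fun _ => ξ) i a)
    have hB2 := B ξ a (Function.update (fun _ => ξ) i b)
    have hC1 := hC i a b c d
    have hC2 := hC i c d a b
    have f1 := hpair (Function.update (fun _ => ξ) i a) c d ξ b
    have f2 := hpair (Function.update (fun _ => ξ) i b) c d ξ a
    have f3 := hanti (Function.update (fun _ => ξ) i a) ξ b c d
    have f4 := hanti (Function.update (fun _ => ξ) i b) ξ a c d
    have f5 := hpair (fun _ => ξ) a b c d
    linarith
  have hN0 : (T (fun _ => ξ) b a c d + T (fun _ => ξ) b c a d)
      - (T (fun _ => ξ) a b c d + T (fun _ => ξ) a c b d)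
      - (T (fun _ => ξ) b a d c + T (fun _ => ξ) b d a c)
      + (T (fun _ => ξ) a b d c + T (fun _ => ξ) a d b c) = -6 * T (fun _ => ξ) a b c d := by
    have h1 := hb1 (fun _ => ξ) b c a d
    have h2 := hb1 (fun _ => ξ) b d a c
    have g1 := hanti (fun _ => ξ) b a c d
    have g2 := hanti (fun _ => ξ) b a d c
    have g3 := hanti2 (fun _ => ξ) a b d c
    have g4 := hanti (fun _ => ξ) c a b d
    have g5 := hanti (fun _ => ξ) d a b c
    linarith
  have s2 := Finset.sum_congr (rfl : (Finset.univ : Finset (Fin k)) = Finset.univ)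
    (fun i _ => Finset.sum_congr (rfl : (Finset.univ : Finset (Fin k)) = Finset.univ)
      (fun j _ => hN2 i j))
  have s1 := Finset.sum_congr (rfl : (Finset.univ : Finset (Fin k)) = Finset.univ)
    (fun i _ => hN1 i)
  have hsum : ∀ (r : ℝ), ∑ i : Fin k, ∑ j : Fin k, (if i = j then 0 else r)
      = (k : ℝ) * ((k : ℝ) - 1) * r := by
    intro r
    have : ∀ i j : Fin k, (if i = j then 0 else r) = r - (if i = j then r else 0) := by
      intro i j; split_ifs <;> simp
    simp [this]
    ring
  rw [hsum] at s2
  rw [Finset.sum_const, Finset.card_univ, Fintype.card_fin, nsmul_eq_mul] at s1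
  rw [Finset.sum_add_distrib, Finset.sum_sub_distrib, Finset.sum_sub_distrib] at s1
  simp only [Finset.sum_add_distrib (f := fun j => _ - _ - _),
    Finset.sum_sub_distrib] at s2
  have E1 := jet_expand T RR hRsym hdiag ξ a c b d
  have E2 := jet_expand T RR hRsym hdiag ξ b c a d
  have E3 := jet_expand T RR hRsym hdiag ξ a d b c
  have E4 := jet_expand T RR hRsym hdiag ξ b d a c
  rw [← jetFix_apply] at E1 E2 E3 E4
  linarith


/-- a linear algebraic curvature `k`-jet `∇ᵏR` is reconstructed from its
symmetrization `𝓡ᵏ` (the polarization of `(ξ;x,y) ↦ ∇ᵏ_{ξ,…,ξ}R(x,ξ,ξ,y)`) by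
`∇ᵏ_{x₁,…,x_k}R(x_a,x_b,x_c,x_d) = -((k+1)/(k+3)) (⧼ 𝓡ᵏ)(x₁,…,x_k;x_a,x_b,x_c,x_d)`,
where `(⧼ h)(v;a,b,c,d) = h(v,a,c;b,d) - h(v,b,c;a,d) - h(v,a,d;b,c) + h(v,b,d;a,c)`.
Here `T` models `∇ᵏR` (multilinear, symmetric in the `k` derivative slots, an algebraic
curvature tensor in the last four slots, second Bianchi identity mixing one derivative
slot with the first two curvature slots), and `RR` models `𝓡ᵏ` (multilinear, symmetric
in its `k+2` slots and in its last two slots, agreeing with the stated diagonal). -/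
theorem jet_reconstruction (V : Type*) [AddCommGroup V] [Module ℝ V] (k : ℕ)
    (T : MultilinearMap ℝ (fun _ : Fin k => V) (V →ₗ[ℝ] V →ₗ[ℝ] V →ₗ[ℝ] V →ₗ[ℝ] ℝ))
    (hTsym : ∀ (v : Fin k → V) (σ : Equiv.Perm (Fin k)), T (v ∘ σ) = T v)
    (hanti : ∀ v a b c d, T v a b c d = - T v b a c d)
    (hpair : ∀ v a b c d, T v a b c d = T v c d a b)
    (hb1 : ∀ v a b c y, T v a b c y + T v b c a y + T v c a b y = 0)
    (hb2 : ∀ (i : Fin k) (v : Fin k → V) (x1 x2 x3 y z : V),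
      T (Function.update v i x1) x2 x3 y z + T (Function.update v i x2) x3 x1 y z
        + T (Function.update v i x3) x1 x2 y z = 0)
    (RR : MultilinearMap ℝ (fun _ : Fin (k + 2) => V) (V →ₗ[ℝ] V →ₗ[ℝ] ℝ))
    (hRsym : ∀ (w : Fin (k + 2) → V) (σ : Equiv.Perm (Fin (k + 2))), RR (w ∘ σ) = RR w)
    (hRsym2 : ∀ w x y, RR w x y = RR w y x)
    (hdiag : ∀ ξ x y, RR (fun _ => ξ) x y = T (fun _ => ξ) x ξ ξ y) :
    ∀ (v : Fin k → V) (a b c d : V),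
      T v a b c d = (-((k : ℝ) + 1) / ((k : ℝ) + 3)) *
        (RR (Fin.snoc (Fin.snoc v a) c) b d - RR (Fin.snoc (Fin.snoc v b) c) a d
          - RR (Fin.snoc (Fin.snoc v a) d) b c + RR (Fin.snoc (Fin.snoc v b) d) a c) := by
  intro v a b c d
  set G : MultilinearMap ℝ (fun _ : Fin k => V) ℝ :=
    (jetEval2 b c).compMultilinearMap ((jetEval a d).compMultilinearMap T)
      - (-((k : ℝ) + 1) / ((k : ℝ) + 3)) • (jetFix RR a c b d - jetFix RR b c a d
          - jetFix RR a d b c + jetFix RR b d a c) with hG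
  have hGv : ∀ w, G w = T w a b c d - (-((k : ℝ) + 1) / ((k : ℝ) + 3)) *
      (jetFix RR a c b d w - jetFix RR b c a d w
          - jetFix RR a d b c w + jetFix RR b d a c w) := fun w => rfl
  have hfix : ∀ (p q x y : V) (w : Fin k → V) (σ : Equiv.Perm (Fin k)),
      jetFix RR p q x y (w ∘ σ) = jetFix RR p q x y w := by
    intro p q x y w σ
    obtain ⟨τ, hτ⟩ := jet_snoc_perm (V := V) σ
    obtain ⟨ρ, hρ⟩ := jet_snoc_perm (V := V) τ
    rw [jetFix_apply, jetFix_apply, hτ, hρ, hRsym]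
  have h0 := jet_sym_zero G (fun w σ => by simp only [hGv, hTsym, hfix]) (fun ξ => by
    rw [hGv]
    have h := jet_diag T hanti hpair hb1 hb2 RR hRsym hdiag ξ a b c d
    have hk : (k : ℝ) + 3 ≠ 0 := by positivity
    have hk2 : (k : ℝ) + 2 ≠ 0 := by positivity
    have h' : -((k : ℝ) + 3) * T (fun _ => ξ) a b c d = ((k : ℝ) + 1) *
        (jetFix RR a c b d (fun _ => ξ) - jetFix RR b c a d (fun _ => ξ)
          - jetFix RR a d b c (fun _ => ξ) + jetFix RR b d a c (fun _ => ξ)) := by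
      apply mul_left_cancel₀ hk2
      linarith
    field_simp
    linarith) v
  rw [hGv] at h0
  exact sub_eq_zero.mp h0
end

section
/- Let $V$ be a real vector space. The map sending an algebraic curvature tensor $R$ to its symmetrization $\mathcal{R} \in \mathcal{N}_2$ (polarization of $\xi \mapsto R(\cdot,\xi,\xi,\cdot)$) is an injective linear map from the space $\mathcal{C}_0$ of algebraic curvature tensors into $\mathcal{N}_2 = \{h \in \mathrm{Sym}^2 V^* \otimes \mathrm{Sym}^2 V^* \mid \forall\xi: h(\xi,\xi;\xi,\cdot)=0\}$, and if $\dim V = n$ it is a linear isomorphism (both spaces have dimension $\frac{n^2(n^2-1)}{12}$). -/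
open Module

/-- The space `𝒞₀` of algebraic curvature tensors on `V`, modelled as quadrilinear forms
satisfying antisymmetry in the first pair, pair symmetry and the first Bianchi identity. -/
noncomputable def CurvSpace (V : Type*) [AddCommGroup V] [Module ℝ V] :
    Submodule ℝ (MultilinearMap ℝ (fun _ : Fin 4 => V) ℝ) where
  carrier := {R |
    (∀ a b c d : V, R ![a, b, c, d] = - R ![b, a, c, d]) ∧
    (∀ a b c d : V, R ![a, b, c, d] = R ![c, d, a, b]) ∧
    (∀ a b c y : V, R ![a, b, c, y] + R ![b, c, a, y] + R ![c, a, b, y] = 0)}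
  add_mem' := fun ha hb =>
    ⟨fun a b c d => by simp only [MultilinearMap.add_apply, ha.1 a b c d, hb.1 a b c d]; ring,
     fun a b c d => by simp only [MultilinearMap.add_apply, ha.2.1 a b c d, hb.2.1 a b c d],
     fun a b c y => by
      simp only [MultilinearMap.add_apply]
      have := ha.2.2 a b c y; have := hb.2.2 a b c y; linarith⟩
  zero_mem' := ⟨fun _ _ _ _ => by simp, fun _ _ _ _ => rfl, fun _ _ _ _ => by simp⟩
  smul_mem' := fun r R hR =>
    ⟨fun a b c d => by simp only [MultilinearMap.smul_apply, hR.1 a b c d, smul_neg],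
     fun a b c d => by simp only [MultilinearMap.smul_apply, hR.2.1 a b c d],
     fun a b c y => by
      simp only [MultilinearMap.smul_apply, ← smul_add, hR.2.2 a b c y, smul_zero]⟩

/-- The space `𝒩₂ ⊆ Sym² V* ⊗ Sym² V*`, modelled as quadrilinear forms `h(a,b;x,y)`
symmetric in `(a,b)` and in `(x,y)` with `h(ξ,ξ;ξ,·) = 0` for all `ξ`. -/
noncomputable def N2Space (V : Type*) [AddCommGroup V] [Module ℝ V] :
    Submodule ℝ (MultilinearMap ℝ (fun _ : Fin 4 => V) ℝ) where
  carrier := {h |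
    (∀ a b x y : V, h ![a, b, x, y] = h ![b, a, x, y]) ∧
    (∀ a b x y : V, h ![a, b, x, y] = h ![a, b, y, x]) ∧
    (∀ ξ x : V, h ![ξ, ξ, ξ, x] = 0)}
  add_mem' := fun ha hb =>
    ⟨fun a b x y => by simp only [MultilinearMap.add_apply, ha.1 a b x y, hb.1 a b x y],
     fun a b x y => by simp only [MultilinearMap.add_apply, ha.2.1 a b x y, hb.2.1 a b x y],
     fun ξ x => by simp only [MultilinearMap.add_apply, ha.2.2 ξ x, hb.2.2 ξ x, add_zero]⟩
  zero_mem' := ⟨fun _ _ _ _ => rfl, fun _ _ _ _ => rfl, fun _ _ => rfl⟩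
  smul_mem' := fun r h hh =>
    ⟨fun a b x y => by simp only [MultilinearMap.smul_apply, hh.1 a b x y],
     fun a b x y => by simp only [MultilinearMap.smul_apply, hh.2.1 a b x y],
     fun ξ x => by simp only [MultilinearMap.smul_apply, hh.2.2 ξ x, smul_zero]⟩

/-- Quadrilinear forms. -/
abbrev QF (V : Type*) [AddCommGroup V] [Module ℝ V] := MultilinearMap ℝ (fun _ : Fin 4 => V) ℝ

/-- Permuting the arguments. -/
noncomputable def permArg (V : Type*) [AddCommGroup V] [Module ℝ V] (σ : Equiv.Perm (Fin 4)) :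
    QF V →ₗ[ℝ] QF V where
  toFun T := T.domDomCongr σ
  map_add' _ _ := rfl
  map_smul' _ _ := rfl

section
variable {V : Type*} [AddCommGroup V] [Module ℝ V]

theorem permArg_apply (σ : Equiv.Perm (Fin 4)) (T : QF V) (v : Fin 4 → V) :
    permArg V σ T v = T ![v (σ 0), v (σ 1), v (σ 2), v (σ 3)] := by
  change T (fun i => v (σ i)) = _
  congr 1
  ext i
  fin_cases i <;> rfl

theorem p01 (T : QF V) (a b c d : V) :
    permArg V (Equiv.swap 0 1) T ![a, b, c, d] = T ![b, a, c, d] := permArg_apply _ _ _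

theorem p23 (T : QF V) (a b c d : V) :
    permArg V (Equiv.swap 2 3) T ![a, b, c, d] = T ![a, b, d, c] := permArg_apply _ _ _

theorem p02 (T : QF V) (a b c d : V) :
    permArg V (Equiv.swap 0 2) T ![a, b, c, d] = T ![c, b, a, d] := permArg_apply _ _ _

theorem p13 (T : QF V) (a b c d : V) :
    permArg V (Equiv.swap 1 3) T ![a, b, c, d] = T ![a, d, c, b] := permArg_apply _ _ _

theorem qf_ext {S T : QF V} (h : ∀ a b c d : V, S ![a, b, c, d] = T ![a, b, c, d]) : S = T := by
  ext v
  have hv : v = ![v 0, v 1, v 2, v 3] := by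
    ext i
    fin_cases i <;> rfl
  rw [hv]
  exact h _ _ _ _

theorem qf_add0 (T : QF V) (a a' b c d : V) :
    T ![a + a', b, c, d] = T ![a, b, c, d] + T ![a', b, c, d] :=
  T.cons_add ![b, c, d] a a'

theorem qf_add1 (T : QF V) (a a' b c d : V) :
    T ![b, a + a', c, d] = T ![b, a, c, d] + T ![b, a', c, d] := by
  have := qf_add0 (permArg V (Equiv.swap 0 1) T) a a' b c d
  simpa only [p01] using this

theorem qf_add2 (T : QF V) (a a' b c d : V) :
    T ![b, c, a + a', d] = T ![b, c, a, d] + T ![b, c, a', d] := by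
  have := qf_add0 (permArg V (Equiv.swap 0 2) T) a a' c b d
  simpa only [p02] using this

/-- The Young projector onto the curvature tensors. -/
noncomputable def youngP (V : Type*) [AddCommGroup V] [Module ℝ V] : QF V →ₗ[ℝ] QF V :=
  (1 / 12 : ℝ) • ((LinearMap.id - permArg V (Equiv.swap 0 1)) ∘ₗ
    (LinearMap.id - permArg V (Equiv.swap 2 3)) ∘ₗ
    (LinearMap.id + permArg V (Equiv.swap 0 2)) ∘ₗ
    (LinearMap.id + permArg V (Equiv.swap 1 3)))

theorem youngP_apply (T : QF V) (a b c d : V) : youngP V T ![a, b, c, d] =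
    (1 / 12 : ℝ) * (
      (T ![a, b, c, d] + T ![a, d, c, b] + T ![c, b, a, d] + T ![c, d, a, b])
      - (T ![a, b, d, c] + T ![a, c, d, b] + T ![d, b, a, c] + T ![d, c, a, b])
      - (T ![b, a, c, d] + T ![b, d, c, a] + T ![c, a, b, d] + T ![c, d, b, a])
      + (T ![b, a, d, c] + T ![b, c, d, a] + T ![d, a, b, c] + T ![d, c, b, a])) := by
  simp only [youngP, LinearMap.smul_apply, LinearMap.comp_apply, LinearMap.add_apply,
    LinearMap.sub_apply, LinearMap.id_apply, MultilinearMap.smul_apply, MultilinearMap.add_apply,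
    MultilinearMap.sub_apply, p01, p02, p13, p23, map_add, map_sub, smul_eq_mul]
  ring

theorem youngP_isProj : LinearMap.IsProj (CurvSpace V) (youngP V) where
  map_mem T := by
    refine ⟨fun a b c d => ?_, fun a b c d => ?_, fun a b c d => ?_⟩ <;>
    simp only [youngP_apply] <;> ring
  map_id T hT := by
    obtain ⟨h1, h2, h3⟩ := hT
    apply qf_ext
    intro a b c d
    have h4 : ∀ a b c d : V, T ![a, b, c, d] = - T ![a, b, d, c] := fun a b c d => by
      rw [h2 a b c d, h1 c d a b, h2 d c a b]
    rw [youngP_apply]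
    linarith [h1 a b c d, h1 a b d c, h4 a b c d, h2 a b c d, h1 c d a b, h4 c d a b,
      h4 b a c d, h4 d c a b, h2 a d c b, h2 a c d b, h2 b d c a, h2 b c d a,
      h1 a d c b, h1 a c d b, h1 b d c a, h1 b c d a, h1 c b a d, h1 d b a c, h1 c a b d,
      h1 d a b c, h4 a d b c, h4 a c b d, h4 b d a c, h4 b c a d, h4 c b a d, h4 d b a c,
      h4 c a b d, h4 d a b c, h3 a b c d, h3 a b d c, h3 c d a b, h3 c d b a]

theorem trace_qf {n : ℕ} (b : Basis (Fin n) ℝ V) (L : QF V →ₗ[ℝ] QF V) :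
    LinearMap.trace ℝ (QF V) L = ∑ i : Fin 4 → Fin n,
      L (Basis.multilinearMap (fun _ : Fin 4 => b) (Basis.singleton Unit ℝ) (i, ()))
        (fun k => b (i k)) := by
  set B := Basis.multilinearMap (fun _ : Fin 4 => b) (Basis.singleton Unit ℝ) with hB
  have key : ∀ (T : QF V) (i : Fin 4 → Fin n), B.repr T (i, ()) = T (fun k => b (i k)) := by
    intro T i
    conv_rhs => rw [← B.sum_repr T]
    rw [MultilinearMap.sum_apply, Finset.sum_eq_single (i, ())]
    · simp [hB, Basis.multilinearMap_apply_apply]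
    · rintro ⟨j, u⟩ _ hj
      have hne : i ≠ j := by
        rintro rfl
        exact hj rfl
      obtain ⟨k, hk⟩ := Function.ne_iff.mp hne
      rw [MultilinearMap.smul_apply, hB, Basis.multilinearMap_apply_apply,
        Finset.prod_eq_zero (Finset.mem_univ k)]
      · simp
      · simp [Finsupp.single_apply, hk]
    · simp
  rw [LinearMap.trace_eq_matrix_trace ℝ B, Matrix.trace, Fintype.sum_prod_type]
  simp [LinearMap.toMatrix_apply, key]

theorem sum_cons {m n : ℕ} (f : (Fin (m + 1) → Fin n) → ℝ) :
    ∑ i, f i = ∑ p, ∑ i : Fin m → Fin n, f (Matrix.vecCons p i) := by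
  rw [← (Fin.consEquiv (fun _ => Fin n)).sum_comp, Fintype.sum_prod_type]
  rfl

theorem sum_fin4 {n : ℕ} (f : (Fin 4 → Fin n) → ℝ) :
    ∑ i, f i = ∑ p, ∑ q, ∑ r, ∑ s, f ![p, q, r, s] := by
  rw [sum_cons]
  refine Finset.sum_congr rfl fun p _ => ?_
  rw [sum_cons]
  refine Finset.sum_congr rfl fun q _ => ?_
  rw [sum_cons]
  refine Finset.sum_congr rfl fun r _ => ?_
  rw [sum_cons]
  refine Finset.sum_congr rfl fun s _ => ?_
  rw [Fintype.sum_subsingleton _ ![]]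

theorem trace_youngP {n : ℕ} (b : Basis (Fin n) ℝ V) :
    LinearMap.trace ℝ (QF V) (youngP V) = (1 / 12 : ℝ) * ((n : ℝ) ^ 4 - (n : ℝ) ^ 2) := by
  rw [trace_qf b, sum_fin4]
  have h : ∀ p q r s : Fin n, (fun k => b (![p, q, r, s] k)) = ![b p, b q, b r, b s] := by
    intro p q r s
    ext i
    fin_cases i <;> rfl
  simp only [h, youngP_apply, Basis.multilinearMap_apply_apply, Fin.prod_univ_four]
  simp [Finsupp.single_apply, Finset.sum_add_distrib, Finset.sum_sub_distrib, ← Finset.mul_sum]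
  ring

theorem proj_trace {M : Type*} [AddCommGroup M] [Module ℝ M] [FiniteDimensional ℝ M]
    (p : Submodule ℝ M) (f : M →ₗ[ℝ] M) (h : LinearMap.IsProj p f) :
    LinearMap.trace ℝ M f = (finrank ℝ p : ℝ) := h.trace

theorem finrank_curv [FiniteDimensional ℝ V] :
    finrank ℝ (CurvSpace V) = finrank ℝ V ^ 2 * (finrank ℝ V ^ 2 - 1) / 12 := by
  have h := proj_trace (CurvSpace V) (youngP V) youngP_isProj
  rw [trace_youngP (finBasis ℝ V)] at h
  set n := finrank ℝ V
  symm
  apply Nat.div_eq_of_eq_mul_right (by norm_num)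
  rcases Nat.eq_zero_or_pos n with hn | hn
  · rw [hn] at h ⊢
    have h' : (finrank ℝ (CurvSpace V) : ℝ) = 0 := by
      rw [← h]
      norm_num
    rw [Nat.cast_eq_zero.mp h']
    norm_num
  · have h1 : 1 ≤ n ^ 2 := Nat.one_le_pow _ _ hn
    have : ((n ^ 2 * (n ^ 2 - 1) : ℕ) : ℝ) = ((12 * finrank ℝ (CurvSpace V) : ℕ) : ℝ) := by
      push_cast [Nat.cast_sub h1]
      rw [← h]
      ring
    exact_mod_cast this

theorem n2_polar {h : QF V} (hh : h ∈ N2Space V) (a b c y : V) :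
    h ![a, b, c, y] + h ![b, c, a, y] + h ![c, a, b, y] = 0 := by
  obtain ⟨h1, h2, h3⟩ := hh
  have e1 := h3 (a + b + c) y
  have e2 := h3 (a + b) y
  have e3 := h3 (b + c) y
  have e4 := h3 (a + c) y
  simp only [qf_add0, qf_add1, qf_add2] at e1 e2 e3 e4
  simp only [h3] at e1 e2 e3 e4
  linarith [h1 a b c y, h1 b c a y, h1 c a b y]

theorem n2_pair {h : QF V} (hh : h ∈ N2Space V) (a b c d : V) :
    h ![a, b, c, d] = h ![c, d, a, b] := by
  have P := n2_polar hh
  obtain ⟨h1, h2, h3⟩ := hh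
  linarith [P a b c d, P a b d c, P c d a b, P c d b a, h2 a b c d, h2 b c a d, h2 c a b d,
    h2 b d a c, h2 d a b c, h2 c d a b, h1 a b c d, h1 b c a d, h1 c a b d, h1 b d a c,
    h1 d a b c, h1 c d a b, h1 a b d c, h1 b c d a, h1 c a d b, h1 b d c a, h1 d a c b, h1 c d b a]
end

/-- the symmetrization map `R ↦ 𝓡` (polarization of `ξ ↦ R(·,ξ,ξ,·)`,
explicitly `𝓡(a,b;x,y) = ½(R(x,a,b,y) + R(x,b,a,y))`) is an injective linear map from
`𝒞₀` into `𝒩₂`; if `dim V = n` it is a linear isomorphism, and both spaces have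
dimension `n²(n²-1)/12`. -/
theorem curvature_to_N2_isomorphism (V : Type*) [AddCommGroup V] [Module ℝ V]
    [FiniteDimensional ℝ V] (n : ℕ) (hn : finrank ℝ V = n)
    (S : MultilinearMap ℝ (fun _ : Fin 4 => V) ℝ →ₗ[ℝ] MultilinearMap ℝ (fun _ : Fin 4 => V) ℝ)
    (hS : ∀ (R : MultilinearMap ℝ (fun _ : Fin 4 => V) ℝ) (a b x y : V),
      S R ![a, b, x, y] = (1/2 : ℝ) * (R ![x, a, b, y] + R ![x, b, a, y])) :
    (∀ R ∈ CurvSpace V, S R ∈ N2Space V) ∧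
    (∀ R ∈ CurvSpace V, S R = 0 → R = 0) ∧
    (∀ h ∈ N2Space V, ∃ R ∈ CurvSpace V, S R = h) ∧
    finrank ℝ (CurvSpace V) = n ^ 2 * (n ^ 2 - 1) / 12 ∧
    finrank ℝ (N2Space V) = n ^ 2 * (n ^ 2 - 1) / 12 := by
  have hA : ∀ R ∈ CurvSpace V, S R ∈ N2Space V := by
    rintro R ⟨h1, h2, h3⟩
    have h4 : ∀ a b c d : V, R ![a, b, c, d] = - R ![a, b, d, c] := fun a b c d => by
      rw [h2 a b c d, h1 c d a b, h2 d c a b]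
    refine ⟨fun a b x y => ?_, fun a b x y => ?_, fun ξ x => ?_⟩
    · rw [hS, hS]; ring
    · rw [hS, hS]
      linarith [h2 x a b y, h1 b y x a, h4 y b x a, h2 x b a y, h1 a y x b, h4 y a x b]
    · rw [hS]
      linarith [h1 ξ ξ ξ x]
  have hB : ∀ R ∈ CurvSpace V, S R = 0 → R = 0 := by
    rintro R ⟨h1, h2, h3⟩ h0
    apply qf_ext
    intro a b c d
    have e : ∀ a b c d : V, R ![a, b, c, d] + R ![a, c, b, d] = 0 := fun a b c d => by
      have := hS R b c a d
      rw [h0, MultilinearMap.zero_apply] at this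
      linarith
    rw [MultilinearMap.zero_apply]
    linarith [e a b c d, e b a c d, h1 a b c d, h3 a b c d, h1 a c b d, h1 b c a d]
  have hC : ∀ h ∈ N2Space V, ∃ R ∈ CurvSpace V, S R = h := by
    intro h hh
    have P := n2_polar hh
    have Q := n2_pair hh
    obtain ⟨h1, h2, h3⟩ := hh
    obtain ⟨R, hR⟩ : ∃ R : QF V, ∀ a b c d : V,
        R ![a, b, c, d] = (2 / 3 : ℝ) * (h ![b, c, a, d] - h ![a, c, b, d]) := by
      refine ⟨(2 / 3 : ℝ) • (permArg V (Equiv.swap 0 2) (permArg V (Equiv.swap 0 1) h) -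
        permArg V (Equiv.swap 0 1) (permArg V (Equiv.swap 0 1) (permArg V (Equiv.swap 0 1)
          (permArg V (Equiv.swap 0 2) (permArg V (Equiv.swap 0 1) h))))), fun a b c d => ?_⟩
      simp only [MultilinearMap.smul_apply, MultilinearMap.sub_apply, p01, p02, smul_eq_mul]
    refine ⟨R, ⟨fun a b c d => ?_, fun a b c d => ?_, fun a b c d => ?_⟩, ?_⟩
    · rw [hR, hR]; ring
    · rw [hR, hR]
      linarith [Q b c a d, h1 a d b c, h2 a d b c, h1 d a c b, h2 d a c b, h2 d a b c,
        h1 a c b d, h2 a c b d, h1 c a d b, h2 c a b d, Q a c b d, h1 b d a c, h2 b d a c,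
        h2 b d c a, h1 c a b d]
    · simp only [hR]
      linarith [h1 a b c d, h1 b c a d, h1 c a b d]
    · apply qf_ext
      intro a b c d
      rw [hS, hR, hR]
      linarith [P a b c d, h1 a b c d, h1 c a b d, h1 c b a d, h1 b c a d]
  refine ⟨hA, hB, hC, ?_, ?_⟩
  · rw [finrank_curv, hn]
  · rw [← hn, ← finrank_curv]
    symm
    refine LinearEquiv.finrank_eq (LinearEquiv.ofBijective (S.restrict hA) ⟨?_, ?_⟩)
    · rintro ⟨R, hR⟩ ⟨T, hT⟩ h0
      have h0' : S R = S T := congrArg Subtype.val h0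
      have hmem : R - T ∈ CurvSpace V := by
        have e : R - T = R + (-1 : ℝ) • T := by
          apply qf_ext
          intro a b c d
          rw [MultilinearMap.sub_apply, MultilinearMap.add_apply, MultilinearMap.smul_apply,
            smul_eq_mul]
          ring
        rw [e]
        exact (CurvSpace V).add_mem hR ((CurvSpace V).smul_mem _ hT)
      have := hB (R - T) hmem (by rw [map_sub, h0', sub_self])
      exact Subtype.ext (sub_eq_zero.mp this)
    · rintro ⟨h, hh⟩
      obtain ⟨R, hR, e⟩ := hC h hh
      exact ⟨⟨R, hR⟩, Subtype.ext e⟩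
end
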